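/- arXiv:1208.2856 — 3 statements merged into one kernel-verified Lean document; each statement's English description precedes it below -/
import Mathlib

section
/- For every n ≥ 0, the abelian complexity function ρ of the ordinary paperfolding word satisfies ρ(4n+2) = ρ(2n+1) + 1. -/
/-- The ordinary paperfolding word over `{0,1}`, indexed from 1:
writing `n = n' * 2^k` with `n'` odd, `pf n = 0` if `n' ≡ 1 (mod 4)`
and `pf n = 1` if `n' ≡ 3 (mod 4)`.  (The value at `0` is irrelevant.) -/
def pf (n : ℕ) : ℕ := if (n / 2 ^ (n.factorization 2)) % 4 = 1 then 0 else 1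

/-- The factor `f_i f_{i+1} ⋯ f_{i+n-1}` of the paperfolding word,
of length `n`, starting at position `i`. -/
def pfFactor (i n : ℕ) : List ℕ := (List.range n).map (fun j => pf (i + j))

/-- `w` is a factor of the ordinary paperfolding word. -/
def IsPFFactor (w : List ℕ) : Prop := ∃ i : ℕ, 1 ≤ i ∧ w = pfFactor i w.length

/-- The abelian complexity function of the ordinary paperfolding word:
the number of abelian equivalence classes of factors of length `n`,
where the class of a factor `w` is determined by the pair
`(|w|_0, |w|_1)` of numbers of occurrences of `0` and `1` in `w`. -/
noncomputable def ρ (n : ℕ) : ℕ :=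
  {p : ℕ × ℕ | ∃ i : ℕ, 1 ≤ i ∧
    p = ((pfFactor i n).count 0, (pfFactor i n).count 1)}.ncard

/-- `Δ w = |w|_0 - |w|_1`. -/
def Δ (w : List ℕ) : ℤ := (w.count 0 : ℤ) - (w.count 1 : ℤ)

/-- `M n` is the maximum of `Δ w` over all factors `w` of the
paperfolding word of length `n`. -/
noncomputable def M (n : ℕ) : ℤ :=
  sSup {d : ℤ | ∃ i : ℕ, 1 ≤ i ∧ d = Δ (pfFactor i n)}

theorem pf_two_mul {m : ℕ} (hm : m ≠ 0) : pf (2 * m) = pf m := by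
  have h : (2 * m).factorization 2 = m.factorization 2 + 1 := by
    rw [Nat.factorization_mul two_ne_zero hm, Finsupp.add_apply,
      Nat.Prime.factorization_self Nat.prime_two, add_comm]
  rw [pf, pf, h, pow_succ', Nat.mul_div_mul_left _ _ two_pos]

theorem pf_two_mul_add_one (m : ℕ) : pf (2 * m + 1) = m % 2 := by
  have h : (2 * m + 1).factorization 2 = 0 :=
    Nat.factorization_eq_zero_of_not_dvd (by omega)
  rw [pf, h, pow_zero, Nat.div_one]
  split_ifs <;> omega

theorem pf_le_one (n : ℕ) : pf n ≤ 1 := by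
  unfold pf
  split_ifs <;> omega

/-- The number of ones in the factor of length `n` starting at position `i`. -/
def pfOnes (n i : ℕ) : ℕ := ∑ k ∈ Finset.range n, pf (i + k)

theorem count_one_pfFactor (i n : ℕ) : (pfFactor i n).count 1 = pfOnes n i := by
  induction n with
  | zero => simp [pfFactor, pfOnes]
  | succ n ih =>
    have h := pf_le_one (i + n)
    simp only [pfFactor, pfOnes] at ih ⊢
    rw [List.range_succ, List.map_append, List.count_append, ih, Finset.sum_range_succ]
    interval_cases hp : pf (i + n) <;> simp [hp]

theorem count_zero_add_pfOnes (i n : ℕ) : (pfFactor i n).count 0 + pfOnes n i = n := by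
  induction n with
  | zero => simp [pfFactor, pfOnes]
  | succ n ih =>
    have h := pf_le_one (i + n)
    simp only [pfFactor, pfOnes] at ih ⊢
    rw [List.range_succ, List.map_append, List.count_append, Finset.sum_range_succ]
    interval_cases hp : pf (i + n) <;> simp [hp] <;> omega

theorem pfOnes_le (n i : ℕ) : pfOnes n i ≤ n := by
  have := count_zero_add_pfOnes i n
  omega

theorem pfOnes_add_pf (n i : ℕ) : pfOnes n (i + 1) + pf i = pfOnes n i + pf (i + n) := by
  simp only [pfOnes]
  rw [← Finset.sum_range_succ (fun k => pf (i + k)), Finset.sum_range_succ']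
  simp only [add_zero, add_assoc, add_comm 1]

theorem rho_eq_ncard_pfOnes (n : ℕ) : ρ n = (pfOnes n '' Set.Ici 1).ncard := by
  have h : {p : ℕ × ℕ | ∃ i : ℕ, 1 ≤ i ∧
      p = ((pfFactor i n).count 0, (pfFactor i n).count 1)} =
      (fun b => (n - b, b)) '' (pfOnes n '' Set.Ici 1) := by
    ext p
    simp only [Set.mem_ofPred_eq, Set.image_image, Set.mem_image, Set.mem_Ici]
    refine exists_congr fun i => and_congr_right fun _ => ?_
    rw [count_one_pfFactor, eq_comm, Nat.eq_sub_of_add_eq (count_zero_add_pfOnes i n)]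
  rw [ρ, h, Set.ncard_image_of_injective]
  intro a b hab
  exact (Prod.ext_iff.mp hab).2

theorem exists_eq_of_unit_steps {f : ℕ → ℕ} {a : ℕ}
    (hf : ∀ i, a ≤ i → f (i + 1) ≤ f i + 1 ∧ f i ≤ f (i + 1) + 1) {i j v : ℕ}
    (hi : a ≤ i) (hij : i ≤ j) (hv : f i ≤ v ∧ v ≤ f j ∨ f j ≤ v ∧ v ≤ f i) :
    ∃ k, a ≤ k ∧ f k = v := by
  induction j, hij using Nat.le_induction with
  | base => exact ⟨i, hi, by omega⟩
  | succ j hij ih =>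
    by_cases h : f (j + 1) = v
    · exact ⟨j + 1, by omega, h⟩
    · have := hf j (by omega)
      exact ih (by omega)

theorem exists_pfOnes_image_eq_Icc (n : ℕ) :
    ∃ a b, a ≤ b ∧ pfOnes n '' Set.Ici 1 = Set.Icc a b := by
  have hfin : (pfOnes n '' Set.Ici 1).Finite :=
    (Set.finite_Iic n).subset (by rintro _ ⟨i, -, rfl⟩; exact pfOnes_le n i)
  have hne : (pfOnes n '' Set.Ici 1).Nonempty := ⟨_, 1, Set.mem_Ici.mpr le_rfl, rfl⟩
  obtain ⟨a, ha, hmin⟩ := hfin.exists_minimal hne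
  obtain ⟨b, hb, hmax⟩ := hfin.exists_maximal hne
  have hlb : ∀ c ∈ pfOnes n '' Set.Ici 1, a ≤ c := fun c hc =>
    (le_total a c).elim id (hmin hc)
  have hub : ∀ c ∈ pfOnes n '' Set.Ici 1, c ≤ b := fun c hc =>
    (le_total c b).elim id (hmax hc)
  refine ⟨a, b, hlb b hb, Set.Subset.antisymm (fun c hc => ⟨hlb c hc, hub c hc⟩) ?_⟩
  obtain ⟨i, hi, rfl⟩ := ha
  obtain ⟨j, hj, rfl⟩ := hb
  rintro v ⟨hv₁, hv₂⟩
  have hstep : ∀ i, 1 ≤ i →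
      pfOnes n (i + 1) ≤ pfOnes n i + 1 ∧ pfOnes n i ≤ pfOnes n (i + 1) + 1 := by
    intro i _
    have h₁ := pfOnes_add_pf n i
    have h₂ := pf_le_one i
    have h₃ := pf_le_one (i + n)
    omega
  rcases le_total i j with h | h
  · exact exists_eq_of_unit_steps hstep hi h (Or.inl ⟨hv₁, hv₂⟩)
  · exact exists_eq_of_unit_steps hstep hj h (Or.inr ⟨hv₁, hv₂⟩)

theorem sum_range_add_mod_two (n j : ℕ) :
    ∑ k ∈ Finset.range (2 * n + 1), (j + k) % 2 = n + j % 2 := by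
  induction n with
  | zero => simp
  | succ n ih =>
    rw [show 2 * (n + 1) + 1 = 2 * n + 1 + 1 + 1 by ring, Finset.sum_range_succ,
      Finset.sum_range_succ, ih]
    omega

theorem sum_range_two_mul (f : ℕ → ℕ) (n : ℕ) :
    ∑ k ∈ Finset.range (2 * n), f k =
      ∑ k ∈ Finset.range n, f (2 * k) + ∑ k ∈ Finset.range n, f (2 * k + 1) := by
  induction n with
  | zero => simp
  | succ n ih =>
    rw [mul_add_one, Finset.sum_range_succ, Finset.sum_range_succ, ih,
      Finset.sum_range_succ, Finset.sum_range_succ]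
    ring

theorem pfOnes_two_mul (n : ℕ) {j : ℕ} (hj : 1 ≤ j) :
    pfOnes (4 * n + 2) (2 * j) = pfOnes (2 * n + 1) j + (n + j % 2) := by
  rw [pfOnes, show 4 * n + 2 = 2 * (2 * n + 1) by ring, sum_range_two_mul, pfOnes,
    ← sum_range_add_mod_two]
  congr 1 <;> refine Finset.sum_congr rfl fun k _ => ?_
  · rw [← mul_add, pf_two_mul (by omega)]
  · rw [← add_assoc, ← mul_add, pf_two_mul_add_one]

theorem pfOnes_two_mul_add_one (n j : ℕ) :
    pfOnes (4 * n + 2) (2 * j + 1) = pfOnes (2 * n + 1) (j + 1) + (n + j % 2) := by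
  rw [pfOnes, show 4 * n + 2 = 2 * (2 * n + 1) by ring, sum_range_two_mul, pfOnes,
    ← sum_range_add_mod_two, add_comm]
  congr 1 <;> refine Finset.sum_congr rfl fun k _ => ?_
  · rw [show 2 * j + 1 + (2 * k + 1) = 2 * (j + 1 + k) by ring, pf_two_mul (by omega)]
  · rw [show 2 * j + 1 + 2 * k = 2 * (j + k) + 1 by ring, pf_two_mul_add_one]

/-- Each factor of length `2 * n + 1` is read off at the even positions of two factors of length
`4 * n + 2`, which have the two possible counts `n` and `n + 1` of ones at odd positions. -/
theorem mem_pfOnes_image_four_mul_add_two (n v : ℕ) :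
    v ∈ pfOnes (4 * n + 2) '' Set.Ici 1 ↔
      ∃ c ∈ pfOnes (2 * n + 1) '' Set.Ici 1, v = c + n ∨ v = c + n + 1 := by
  constructor
  · rintro ⟨i, hi, rfl⟩
    rw [Set.mem_Ici] at hi
    rcases Nat.even_or_odd' i with ⟨j, rfl | rfl⟩
    · refine ⟨_, ⟨j, Set.mem_Ici.mpr (by omega), rfl⟩, ?_⟩
      rw [pfOnes_two_mul n (by omega)]
      omega
    · refine ⟨_, ⟨j + 1, Set.mem_Ici.mpr (by omega), rfl⟩, ?_⟩
      rw [pfOnes_two_mul_add_one]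
      omega
  · rintro ⟨_, ⟨j, hj, rfl⟩, hv⟩
    rw [Set.mem_Ici] at hj
    obtain ⟨j, rfl⟩ := Nat.exists_eq_add_of_le' hj
    have h₁ := pfOnes_two_mul n hj
    have h₂ := pfOnes_two_mul_add_one n j
    by_cases h : v = pfOnes (4 * n + 2) (2 * (j + 1))
    · exact ⟨_, Set.mem_Ici.mpr (by omega), h.symm⟩
    · exact ⟨2 * j + 1, Set.mem_Ici.mpr (by omega), by omega⟩

theorem pf_rho_four_mul_add_two : ∀ n : ℕ, ρ (4 * n + 2) = ρ (2 * n + 1) + 1 := by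
  intro n
  obtain ⟨a, b, hab, h⟩ := exists_pfOnes_image_eq_Icc (2 * n + 1)
  have h' : pfOnes (4 * n + 2) '' Set.Ici 1 = Set.Icc (a + n) (b + n + 1) := by
    ext v
    rw [mem_pfOnes_image_four_mul_add_two, h]
    simp only [Set.mem_Icc]
    constructor
    · rintro ⟨c, hc, hv⟩
      omega
    · intro hv
      by_cases hvb : v ≤ b + n
      · exact ⟨v - n, by omega, by omega⟩
      · exact ⟨b, by omega, by omega⟩
  rw [rho_eq_ncard_pfOnes, rho_eq_ncard_pfOnes, h, h', ← Finset.coe_Icc, ← Finset.coe_Icc,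
    Set.ncard_coe_finset, Set.ncard_coe_finset, Nat.card_Icc, Nat.card_Icc]
  omega
end

section
/- For every n ≥ 0, the abelian complexity function ρ of the ordinary paperfolding word satisfies ρ(16n+7) = ρ(2n+1) + 2. -/
theorem pf_eq_zero_or_one (n : ℕ) : pf n = 0 ∨ pf n = 1 := by
  unfold pf
  split_ifs <;> simp

theorem pf_two_mul_s6 {n : ℕ} (hn : n ≠ 0) : pf (2 * n) = pf n := by
  have h : (2 * n).factorization 2 = n.factorization 2 + 1 := by
    rw [Nat.factorization_mul two_ne_zero hn, Finsupp.add_apply,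
      Nat.prime_two.factorization_self, add_comm]
  simp only [pf, h, pow_succ']
  rw [Nat.mul_div_mul_left _ _ two_pos]

/-- The sum of `(-1) ^ pf j` over `1 ≤ j ≤ k`. -/
def pfSum (k : ℕ) : ℤ := ∑ j ∈ Finset.range k, (1 - 2 * (pf (j + 1) : ℤ))

theorem pfSum_succ (k : ℕ) : pfSum (k + 1) = pfSum k + (1 - 2 * (pf (k + 1) : ℤ)) :=
  Finset.sum_range_succ _ _

theorem pfSum_zero : pfSum 0 = 0 :=
  Finset.sum_range_zero _

theorem pfSum_succ_eq (k : ℕ) : pfSum (k + 1) = pfSum k + 1 ∨ pfSum (k + 1) = pfSum k - 1 := by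
  rw [pfSum_succ]
  rcases pf_eq_zero_or_one (k + 1) with h | h <;> omega

theorem pfSum_two_mul_add_one_eq_add (m : ℕ) :
    pfSum (2 * m + 1) = pfSum (2 * m) + (1 - 2 * ((m % 2 : ℕ) : ℤ)) := by
  rw [pfSum_succ, pf_two_mul_add_one]

theorem pfSum_two_mul (m : ℕ) : pfSum (2 * m) = pfSum m + ((m % 2 : ℕ) : ℤ) := by
  induction m with
  | zero => simp [pfSum_zero]
  | succ m ih =>
    have h := pfSum_succ (2 * m + 1)
    rw [show 2 * m + 1 + 1 = 2 * (m + 1) by ring, pf_two_mul_s6 (Nat.add_one_ne_zero m),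
      pfSum_two_mul_add_one_eq_add, ih] at h
    rw [h, pfSum_succ]
    omega

theorem pfSum_two_mul_add_one (m : ℕ) :
    pfSum (2 * m + 1) = pfSum m + (((m + 1) % 2 : ℕ) : ℤ) := by
  rw [pfSum_two_mul_add_one_eq_add, pfSum_two_mul]
  omega

theorem pfSum_eight_mul_add (b : ℕ) :
    pfSum (8 * b) = pfSum b + ((b % 2 : ℕ) : ℤ) ∧
    pfSum (8 * b + 1) = pfSum b + 1 + ((b % 2 : ℕ) : ℤ) ∧
    pfSum (8 * b + 2) = pfSum b + 2 + ((b % 2 : ℕ) : ℤ) ∧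
    pfSum (8 * b + 3) = pfSum b + 1 + ((b % 2 : ℕ) : ℤ) ∧
    pfSum (8 * b + 4) = pfSum b + 2 - ((b % 2 : ℕ) : ℤ) ∧
    pfSum (8 * b + 5) = pfSum b + 3 - ((b % 2 : ℕ) : ℤ) ∧
    pfSum (8 * b + 6) = pfSum b + 2 - ((b % 2 : ℕ) : ℤ) ∧
    pfSum (8 * b + 7) = pfSum b + 1 - ((b % 2 : ℕ) : ℤ) := by
  refine ⟨?_, ?_, ?_, ?_, ?_, ?_, ?_, ?_⟩
  · rw [show 8 * b = 2 * (2 * (2 * b)) by ring]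
    simp only [pfSum_two_mul]
    omega
  · rw [show 8 * b + 1 = 2 * (2 * (2 * b)) + 1 by ring]
    simp only [pfSum_two_mul, pfSum_two_mul_add_one]
    omega
  · rw [show 8 * b + 2 = 2 * (2 * (2 * b) + 1) by ring]
    simp only [pfSum_two_mul, pfSum_two_mul_add_one]
    omega
  · rw [show 8 * b + 3 = 2 * (2 * (2 * b) + 1) + 1 by ring]
    simp only [pfSum_two_mul, pfSum_two_mul_add_one]
    omega
  · rw [show 8 * b + 4 = 2 * (2 * (2 * b + 1)) by ring]
    simp only [pfSum_two_mul, pfSum_two_mul_add_one]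
    omega
  · rw [show 8 * b + 5 = 2 * (2 * (2 * b + 1)) + 1 by ring]
    simp only [pfSum_two_mul, pfSum_two_mul_add_one]
    omega
  · rw [show 8 * b + 6 = 2 * (2 * (2 * b + 1) + 1) by ring]
    simp only [pfSum_two_mul, pfSum_two_mul_add_one]
    omega
  · rw [show 8 * b + 7 = 2 * (2 * (2 * b + 1) + 1) + 1 by ring]
    simp only [pfSum_two_mul_add_one]
    omega

/-- The difference between the numbers of zeros and of ones in the factor of length `n`
starting at position `a + 1`. -/
def pfDiff (n a : ℕ) : ℤ := pfSum (a + n) - pfSum a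

theorem pfDiff_succ (n a : ℕ) :
    pfDiff n (a + 1) = pfDiff n a ∨ pfDiff n (a + 1) = pfDiff n a + 2 ∨
      pfDiff n (a + 1) = pfDiff n a - 2 := by
  have h1 := pfSum_succ_eq a
  have h2 := pfSum_succ_eq (a + n)
  simp only [pfDiff, add_right_comm a 1 n]
  omega

theorem abs_pfDiff_le (n a : ℕ) : |pfDiff n a| ≤ n := by
  induction n with
  | zero => simp [pfDiff]
  | succ n ih =>
    have h := pfSum_succ_eq (a + n)
    simp only [pfDiff, ← add_assoc, abs_le] at ih ⊢
    push_cast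
    omega

theorem count_pfFactor (n a : ℕ) :
    (pfFactor (a + 1) n).count 0 + (pfFactor (a + 1) n).count 1 = n ∧
    ((pfFactor (a + 1) n).count 0 : ℤ) - (pfFactor (a + 1) n).count 1 = pfDiff n a := by
  induction n with
  | zero => simp [pfFactor, pfDiff]
  | succ n ih =>
    have h := pfSum_succ (a + n)
    have hs : pfFactor (a + 1) (n + 1) = pfFactor (a + 1) n ++ [pf (a + n + 1)] := by
      simp [pfFactor, List.range_succ, add_right_comm]
    rw [hs]
    simp only [pfDiff, List.count_append, ← add_assoc] at ih ⊢
    rcases pf_eq_zero_or_one (a + n + 1) with h0 | h0 <;> rw [h0] at h ⊢ <;> simp <;> omega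

theorem rho_eq_ncard_range_pfDiff (n : ℕ) : ρ n = (Set.range (pfDiff n)).ncard := by
  have himage : Set.range (pfDiff n) = (fun p : ℕ × ℕ => (p.1 : ℤ) - p.2) ''
      {p : ℕ × ℕ | ∃ i : ℕ, 1 ≤ i ∧
        p = ((pfFactor i n).count 0, (pfFactor i n).count 1)} := by
    ext x
    constructor
    · rintro ⟨a, rfl⟩
      exact ⟨_, ⟨a + 1, by omega, rfl⟩, (count_pfFactor n a).2⟩
    · rintro ⟨_, ⟨i, hi, rfl⟩, rfl⟩
      obtain ⟨a, rfl⟩ := Nat.exists_eq_add_of_le' hi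
      exact ⟨a, (count_pfFactor n a).2.symm⟩
  rw [himage, Set.InjOn.ncard_image, ρ]
  rintro _ ⟨i, hi, rfl⟩ _ ⟨j, hj, rfl⟩ hij
  obtain ⟨a, rfl⟩ := Nat.exists_eq_add_of_le' hi
  obtain ⟨b, rfl⟩ := Nat.exists_eq_add_of_le' hj
  have ha := (count_pfFactor n a).1
  have hb := (count_pfFactor n b).1
  simp only [Prod.mk.injEq] at hij ⊢
  omega

/-- A discrete intermediate value theorem for sequences with steps in `{-2, 0, 2}`. -/
theorem exists_eq_add_two_of_lt {u : ℕ → ℤ}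
    (hu : ∀ a, u (a + 1) = u a ∨ u (a + 1) = u a + 2 ∨ u (a + 1) = u a - 2)
    {a b : ℕ} (hab : u a < u b) : ∃ k, u k = u a + 2 := by
  have hpar : ∀ k, u k % 2 = u 0 % 2 := by
    intro k
    induction k with
    | zero => rfl
    | succ k ih => have := hu k; omega
  by_contra! hne
  have hside : ∀ k, u k ≤ u a ↔ u 0 ≤ u a := by
    intro k
    induction k with
    | zero => rfl
    | succ k ih =>
      have := hu k
      have := hne k
      have := hne (k + 1)
      have := hpar k
      have := hpar a
      omega
  have := hside a
  have := hside b
  omega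

theorem exists_eq_sub_two_of_lt {u : ℕ → ℤ}
    (hu : ∀ a, u (a + 1) = u a ∨ u (a + 1) = u a + 2 ∨ u (a + 1) = u a - 2)
    {a b : ℕ} (hab : u b < u a) : ∃ k, u k = u a - 2 := by
  obtain ⟨k, hk⟩ := exists_eq_add_two_of_lt (u := fun k => -u k) (a := a) (b := b)
    (fun k => by have := hu k; omega) (by omega)
  exact ⟨k, by omega⟩

theorem ncard_range_widened {u : ℕ → ℤ}
    (hu : ∀ a, u (a + 1) = u a ∨ u (a + 1) = u a + 2 ∨ u (a + 1) = u a - 2)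
    {B : ℤ} (hB : ∀ a, |u a| ≤ B) :
    {x : ℤ | ∃ a, x = u a ∨ x = u a + 2 ∨ x = u a - 2}.ncard = (Set.range u).ncard + 2 := by
  have hfin : (Set.range u).Finite := (Set.finite_Icc (-B) B).subset (by
    rintro _ ⟨a, rfl⟩
    exact abs_le.mp (hB a))
  obtain ⟨_, ⟨a, rfl⟩, ha⟩ := hfin.exists_maximal (Set.range_nonempty u)
  obtain ⟨_, ⟨b, rfl⟩, hb⟩ := hfin.exists_minimal (Set.range_nonempty u)
  have hmax : ∀ k, u k ≤ u a := fun k => by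
    by_contra! h
    exact absurd (ha ⟨k, rfl⟩ h.le) (not_le.mpr h)
  have hmin : ∀ k, u b ≤ u k := fun k => by
    by_contra! h
    exact absurd (hb ⟨k, rfl⟩ h.le) (not_le.mpr h)
  have heq : {x : ℤ | ∃ a, x = u a ∨ x = u a + 2 ∨ x = u a - 2} =
      insert (u a + 2) (insert (u b - 2) (Set.range u)) := by
    ext x
    simp only [Set.mem_ofPred_eq, Set.mem_insert_iff, Set.mem_range]
    constructor
    · rintro ⟨k, rfl | rfl | rfl⟩
      · exact Or.inr (Or.inr ⟨k, rfl⟩)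
      · rcases (hmax k).eq_or_lt with h | h
        · exact Or.inl (by rw [h])
        · exact Or.inr (Or.inr (exists_eq_add_two_of_lt hu h))
      · rcases (hmin k).eq_or_lt with h | h
        · exact Or.inr (Or.inl (by rw [h]))
        · exact Or.inr (Or.inr (exists_eq_sub_two_of_lt hu h))
    · rintro (rfl | rfl | ⟨k, rfl⟩)
      · exact ⟨a, by simp⟩
      · exact ⟨b, by simp⟩
      · exact ⟨k, by simp⟩
  have hb_notMem : u b - 2 ∉ Set.range u := by
    rintro ⟨k, hk⟩
    have := hmin k
    omega
  have ha_notMem : u a + 2 ∉ insert (u b - 2) (Set.range u) := by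
    rintro (h | ⟨k, hk⟩)
    · have := hmin a
      omega
    · have := hmax k
      omega
  rw [heq, Set.ncard_insert_of_notMem ha_notMem (hfin.insert _),
    Set.ncard_insert_of_notMem hb_notMem hfin]

theorem pfDiff_sixteen_mul_add_seven_eight_mul_add (n b : ℕ) :
    pfDiff (16 * n + 7) (8 * b + 1) = pfDiff (2 * n + 1) b - 2 * ((b % 2 : ℕ) : ℤ) ∧
    pfDiff (16 * n + 7) (8 * b + 2) = pfDiff (2 * n + 1) b - 2 * ((b % 2 : ℕ) : ℤ) ∧
    pfDiff (16 * n + 7) (8 * b + 3) = pfDiff (2 * n + 1) b + 2 - 2 * ((b % 2 : ℕ) : ℤ) ∧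
    pfDiff (16 * n + 7) (8 * b + 4) = pfDiff (2 * n + 1) b ∧
    pfDiff (16 * n + 7) (8 * b + 5) = pfDiff (2 * n + 1) b - 2 + 2 * ((b % 2 : ℕ) : ℤ) ∧
    pfDiff (16 * n + 7) (8 * b + 6) = pfDiff (2 * n + 1) b + 2 * ((b % 2 : ℕ) : ℤ) ∧
    pfDiff (16 * n + 7) (8 * b + 7) = pfDiff (2 * n + 1) b + 2 * ((b % 2 : ℕ) : ℤ) := by
  obtain ⟨-, hb1, hb2, hb3, hb4, hb5, hb6, hb7⟩ := pfSum_eight_mul_add b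
  obtain ⟨hc0, hc1, hc2, hc3, hc4, hc5, hc6, -⟩ := pfSum_eight_mul_add (b + (2 * n + 1))
  have hodd : (((b + (2 * n + 1)) % 2 : ℕ) : ℤ) = 1 - ((b % 2 : ℕ) : ℤ) := by omega
  have hshift (r : ℕ) : 8 * b + (r + 1) + (16 * n + 7) = 8 * (b + (2 * n + 1)) + r := by ring
  rw [hodd] at hc0 hc1 hc2 hc3 hc4 hc5 hc6
  simp only [pfDiff]
  refine ⟨?_, ?_, ?_, ?_, ?_, ?_, ?_⟩
  · rw [hshift 0, add_zero, hc0, hb1]; ring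
  · rw [hshift 1, hc1, hb2]; ring
  · rw [hshift 2, hc2, hb3]; ring
  · rw [hshift 3, hc3, hb4]; ring
  · rw [hshift 4, hc4, hb5]; ring
  · rw [hshift 5, hc5, hb6]; ring
  · rw [hshift 6, hc6, hb7]; ring

theorem pfDiff_sixteen_mul_add_seven_eight_mul (n b : ℕ) :
    pfDiff (16 * n + 7) (8 * b) = pfDiff (2 * n + 1) b ∨
    pfDiff (16 * n + 7) (8 * b) = pfDiff (2 * n + 1) b + 2 ∨
    pfDiff (16 * n + 7) (8 * b) = pfDiff (2 * n + 1) b - 2 := by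
  have h0 := (pfSum_eight_mul_add b).1
  have h7 := (pfSum_eight_mul_add (b + 2 * n)).2.2.2.2.2.2.2
  have hpar : (b + 2 * n) % 2 = b % 2 := by omega
  have hstep := pfSum_succ_eq (b + 2 * n)
  rw [pfDiff, pfDiff, show 8 * b + (16 * n + 7) = 8 * (b + 2 * n) + 7 by ring, h7, h0, hpar,
    ← add_assoc b]
  omega

theorem range_pfDiff_sixteen_mul_add_seven (n : ℕ) :
    Set.range (pfDiff (16 * n + 7)) =
      {x : ℤ | ∃ a, x = pfDiff (2 * n + 1) a ∨ x = pfDiff (2 * n + 1) a + 2 ∨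
        x = pfDiff (2 * n + 1) a - 2} := by
  ext x
  simp only [Set.mem_range, Set.mem_ofPred_eq]
  constructor
  · rintro ⟨a, rfl⟩
    obtain ⟨b, r, hr, rfl⟩ : ∃ b r, r < 8 ∧ a = 8 * b + r :=
      ⟨a / 8, a % 8, by omega, by omega⟩
    refine ⟨b, ?_⟩
    obtain ⟨h1, h2, h3, h4, h5, h6, h7⟩ := pfDiff_sixteen_mul_add_seven_eight_mul_add n b
    interval_cases r
    · exact pfDiff_sixteen_mul_add_seven_eight_mul n b
    · rw [h1]; omega
    · rw [h2]; omega
    · rw [h3]; omega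
    · rw [h4]; omega
    · rw [h5]; omega
    · rw [h6]; omega
    · rw [h7]; omega
  · rintro ⟨b, hx⟩
    obtain ⟨-, h2, h3, h4, h5, h6, -⟩ := pfDiff_sixteen_mul_add_seven_eight_mul_add n b
    rcases hx with rfl | rfl | rfl
    · exact ⟨_, h4⟩
    · rcases Nat.mod_two_eq_zero_or_one b with hpar | hpar
      · exact ⟨_, h3.trans (by rw [hpar]; simp)⟩
      · exact ⟨_, h6.trans (by rw [hpar]; simp)⟩
    · rcases Nat.mod_two_eq_zero_or_one b with hpar | hpar
      · exact ⟨_, h5.trans (by rw [hpar]; simp)⟩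
      · exact ⟨_, h2.trans (by rw [hpar]; simp)⟩

theorem pf_rho_sixteen_mul_add_seven : ∀ n : ℕ, ρ (16 * n + 7) = ρ (2 * n + 1) + 2 := by
  intro n
  rw [rho_eq_ncard_range_pfDiff, rho_eq_ncard_range_pfDiff, range_pfDiff_sixteen_mul_add_seven]
  exact ncard_range_widened (pfDiff_succ _) (abs_pfDiff_le _)
end

section
/- If w is a factor of the ordinary paperfolding word, then so is the reverse complement of w, i.e., the word obtained from w by reversing it and exchanging 0's and 1's. -/
theorem pf_two_pow_mul {m : ℕ} (k : ℕ) (hm : m % 2 = 1) :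
    pf (2 ^ k * m) = if m % 4 = 1 then 0 else 1 := by
  have hfac : (2 ^ k * m).factorization 2 = k := by
    rw [Nat.factorization_mul (by positivity) (by lia), Nat.prime_two.factorization_pow]
    simp [Nat.factorization_eq_zero_of_not_dvd (show ¬ 2 ∣ m by lia)]
  rw [pf, hfac, Nat.mul_div_cancel_left m (by positivity)]

theorem pf_two_pow_sub {K m : ℕ} (hm : 0 < m) (hmK : m < 2 ^ K) :
    pf (2 ^ (K + 1) - m) = 1 - pf m := by
  obtain ⟨k, a, ha, rfl⟩ := Nat.exists_eq_two_pow_mul_odd hm.ne'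
  rw [Nat.odd_iff] at ha
  have hk : k < K :=
    (Nat.pow_lt_pow_iff_right one_lt_two).1 ((Nat.le_mul_of_pos_right _ (by lia)).trans_lt hmK)
  obtain ⟨d, rfl⟩ := Nat.exists_eq_add_of_lt hk
  have hpow : 2 ^ (k + d + 1 + 1) = 2 ^ k * (4 * 2 ^ d) := by ring
  have ha_lt : a < 2 * 2 ^ d := by
    refine Nat.lt_of_mul_lt_mul_left (a := 2 ^ k) (hmK.trans_eq ?_)
    ring
  rw [hpow, ← Nat.mul_sub, pf_two_pow_mul k ha, pf_two_pow_mul k (by lia)]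
  split_ifs <;> lia

/-- If `w` is a factor of the paperfolding word, then so is its reverse
complement (reverse `w` and exchange `0`s and `1`s). -/
theorem pf_reverse_complement_isFactor (w : List ℕ) (hw : IsPFFactor w) :
    IsPFFactor ((w.map (fun a => 1 - a)).reverse) := by
  obtain ⟨i, hi, hw⟩ := hw
  generalize w.length = n at hw
  subst hw
  have hlt : i + n < 2 ^ (i + n) := Nat.lt_two_pow_self
  have hpow : 2 ^ (i + n + 1) = 2 * 2 ^ (i + n) := by ring
  refine ⟨2 ^ (i + n + 1) + 1 - (i + n), by lia, ?_⟩
  apply List.ext_getElem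
  · simp [pfFactor]
  · intro j hj _
    have hjn : j < n := by simpa [pfFactor] using hj
    have hidx : 2 ^ (i + n + 1) + 1 - (i + n) + j = 2 ^ (i + n + 1) - (i + (n - 1 - j)) := by lia
    simp only [pfFactor, List.getElem_reverse, List.getElem_map, List.getElem_range,
      List.length_map, List.length_range]
    rw [hidx, pf_two_pow_sub (by lia) (by lia)]
end
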